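/- Whitney extension consequence: Let Q ⊆ ℝ^n be a cube, F : Q → ℝ a function, and suppose there exist polynomials P_x of degree ≤ m−1 for each x ∈ Q and a constant A ≥ 0 such that P_x(x) = F(x) for all x ∈ Q and |P_x − P_y|_{x,|x−y|} ≤ A for all x, y ∈ Q. Then F ∈ C^{m−1, 1−n/p}(Q), J_x F = P_x for all x ∈ Q, and ‖F‖_{C^{m−1,1−n/p}(Q)} ≤ C·A with C = C(m,n,p). -/

import Mathlib

noncomputable section

/-- The partial sum `Σ_{i=1}^k α_i` of a multi-index `α ∈ ℕ^n`. -/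
def partialSum {n : ℕ} (α : Fin n → ℕ) (k : ℕ) : ℕ :=
  ∑ i ∈ Finset.univ.filter (fun i : Fin n => (i : ℕ) < k), α i

/-- The strict order on multi-indices: `α < β` iff at the maximal `k ∈ {0,…,n}` with
`Σ_{i=1}^k α_i ≠ Σ_{i=1}^k β_i` one has `Σ_{i=1}^k α_i < Σ_{i=1}^k β_i`. -/
def MIlt {n : ℕ} (α β : Fin n → ℕ) : Prop :=
  ∃ k ≤ n, partialSum α k < partialSum β k ∧
    ∀ j, k < j → j ≤ n → partialSum α j = partialSum β j

/-- The finite set `M` of multi-indices `α ∈ ℕ^n` of order `|α| ≤ m − 1` (for `m ≥ 1`). -/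
def multiIndices (n m : ℕ) : Finset (Fin n → ℕ) :=
  (Fintype.piFinset fun _ : Fin n => Finset.range m).filter fun α => (∑ i, α i) ≤ m - 1

def mderivList {n : ℕ} : List (Fin n) → MvPolynomial (Fin n) ℝ → MvPolynomial (Fin n) ℝ
  | [], P => P
  | i :: is, P => MvPolynomial.pderiv i (mderivList is P)

/-- The iterated partial derivative `∂^β P` of a polynomial `P` on `ℝ^n`. -/
def mderiv {n : ℕ} (β : Fin n → ℕ) (P : MvPolynomial (Fin n) ℝ) : MvPolynomial (Fin n) ℝ :=
  mderivList ((List.finRange n).flatMap fun i => List.replicate (β i) i) P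

/-- The scaled norm `|P|_{x,δ} = (Σ_{|β| ≤ m−1} |∂^β P(x)|^p δ^{n+(|β|−m)p})^{1/p}`
on polynomials of degree `≤ m − 1`. -/
def pNorm (n m : ℕ) (p : ℝ) (P : MvPolynomial (Fin n) ℝ) (x : Fin n → ℝ) (δ : ℝ) : ℝ :=
  (∑ β ∈ multiIndices n m,
      |MvPolynomial.eval x (mderiv β P)| ^ p *
        δ ^ ((n : ℝ) + ((∑ i, β i : ℕ) : ℝ) * p - (m : ℝ) * p)) ^ (1 / p)

/-- `(P^α)_{α ∈ A}` forms an `(A, x, ε, δ)`-basis for the symmetric convex set `σ`: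
(i) `P^α ∈ ε δ^{n/p+|α|−m} σ`; (ii) `∂^β P^α(x) = δ_{αβ}` for `α, β ∈ A`;
(iii) `|∂^β P^α(x)| ≤ ε δ^{|α|−|β|}` for `α ∈ A` and `β ∈ M` with `β > α`. -/
def IsABasis (n m : ℕ) (p : ℝ) (A : Finset (Fin n → ℕ)) (x : Fin n → ℝ) (ε δ : ℝ)
    (σ : Set (MvPolynomial (Fin n) ℝ)) (P : (Fin n → ℕ) → MvPolynomial (Fin n) ℝ) : Prop :=
  (∀ α ∈ A, ∃ Q ∈ σ,
      P α = (ε * δ ^ ((n : ℝ) / p + ((∑ i, α i : ℕ) : ℝ) - (m : ℝ))) • Q) ∧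
  (∀ α ∈ A, ∀ β ∈ A, MvPolynomial.eval x (mderiv β (P α)) = if α = β then 1 else 0) ∧
  (∀ α ∈ A, ∀ β ∈ multiIndices n m, MIlt α β →
      |MvPolynomial.eval x (mderiv β (P α))| ≤
        ε * δ ^ (((∑ i, α i : ℕ) : ℝ) - ((∑ i, β i : ℕ) : ℝ)))

/-- The partial derivative `∂_i f` of a function on `ℝ^n` (via the Fréchet derivative). -/
def pdIdx (n : ℕ) (i : Fin n) (f : (Fin n → ℝ) → ℝ) : (Fin n → ℝ) → ℝ :=
  fun x => fderiv ℝ f x (Pi.single i 1)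

def pdList (n : ℕ) : List (Fin n) → ((Fin n → ℝ) → ℝ) → ((Fin n → ℝ) → ℝ)
  | [], f => f
  | i :: is, f => pdIdx n i (pdList n is f)

/-- The iterated partial derivative `∂^α f` of a function on `ℝ^n`. -/
def pdAlpha (n : ℕ) (α : Fin n → ℕ) (f : (Fin n → ℝ) → ℝ) : (Fin n → ℝ) → ℝ :=
  pdList n ((List.finRange n).flatMap fun i => List.replicate (α i) i) f

/-- The `(m−1)`-jet (degree-`(m−1)` Taylor polynomial) of a function `F` at `y ∈ ℝ^n`. -/
def jet (n m : ℕ) (F : (Fin n → ℝ) → ℝ) (y : Fin n → ℝ) : MvPolynomial (Fin n) ℝ :=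
  ∑ α ∈ multiIndices n m,
    MvPolynomial.C (pdAlpha n α F y / ∏ i, (Nat.factorial (α i) : ℝ)) *
      ∏ i, (MvPolynomial.X i - MvPolynomial.C (y i)) ^ α i

/-- The closed axis-parallel cube with center `ctr` and sidelength `δ` in `ℝ^n`. -/
def cube (n : ℕ) (ctr : Fin n → ℝ) (δ : ℝ) : Set (Fin n → ℝ) :=
  {x | ∀ i, |x i - ctr i| ≤ δ / 2}


lemma mderivList_perm {n : ℕ} {l l' : List (Fin n)} (h : l.Perm l')
    (P : MvPolynomial (Fin n) ℝ) : mderivList l P = mderivList l' P := by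
  induction h with
  | nil => rfl
  | cons x _ ih => simp only [mderivList, ih]
  | swap x y l =>
    simp only [mderivList]
    ext d
    simp only [MvPolynomial.coeff_pderiv]
    by_cases hxy : x = y
    · subst hxy; rfl
    · have h1 : y ≠ x := fun h => hxy h.symm
      simp only [Finsupp.add_apply, Finsupp.single_apply, if_neg hxy, if_neg h1, add_zero]
      rw [add_right_comm]
      ring
  | trans _ _ ih1 ih2 => rw [ih1, ih2]

/-- canonical list -/
def canon {n : ℕ} (β : Fin n → ℕ) : List (Fin n) :=
  (List.finRange n).flatMap fun i => List.replicate (β i) i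

lemma count_canon {n : ℕ} (β : Fin n → ℕ) (i : Fin n) : (canon β).count i = β i := by
  unfold canon
  rw [List.count_flatMap]
  simp only [Function.comp_def, List.count_replicate]
  rw [← List.ofFn_eq_map, List.sum_ofFn]
  simp

lemma length_eq_sum_count {n : ℕ} (l : List (Fin n)) : l.length = ∑ i, l.count i := by
  induction l with
  | nil => simp
  | cons a l ih => simp [List.count_cons, Finset.sum_add_distrib, ih]

lemma length_canon {n : ℕ} (β : Fin n → ℕ) : (canon β).length = ∑ i, β i := by
  rw [length_eq_sum_count]; simp [count_canon]

lemma mderivList_eq_mderiv {n : ℕ} (l : List (Fin n)) (P : MvPolynomial (Fin n) ℝ) :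
    mderivList l P = mderiv (fun i => l.count i) P := by
  apply mderivList_perm
  rw [List.perm_iff_count]
  intro a
  exact (count_canon (fun i => l.count i) a).symm

lemma mem_multiIndices {n m : ℕ} (hm : 1 ≤ m) (β : Fin n → ℕ) :
    β ∈ multiIndices n m ↔ ∑ i, β i ≤ m - 1 := by
  unfold multiIndices
  simp only [Finset.mem_filter, Fintype.mem_piFinset, Finset.mem_range, and_iff_right_iff_imp]
  intro h i
  have : β i ≤ ∑ i, β i := Finset.single_le_sum (f := β) (fun _ _ => Nat.zero_le _) (Finset.mem_univ i)
  omega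

lemma mderivList_sub {n : ℕ} (l : List (Fin n)) (P Q : MvPolynomial (Fin n) ℝ) :
    mderivList l (P - Q) = mderivList l P - mderivList l Q := by
  induction l with
  | nil => rfl
  | cons a l ih => simp [mderivList, ih]

lemma mderivList_coeff_eq_zero {n : ℕ} (l : List (Fin n)) (P : MvPolynomial (Fin n) ℝ) (k : ℕ)
    (hP : P.totalDegree ≤ k) (d : Fin n →₀ ℕ) (hd : k < d.degree + l.length) :
    (mderivList l P).coeff d = 0 := by
  induction l generalizing d with
  | nil =>
    apply MvPolynomial.coeff_eq_zero_of_totalDegree_lt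
    simp only [List.length_nil, add_zero] at hd
    rw [Finsupp.degree_apply] at hd
    exact lt_of_le_of_lt hP hd
  | cons a l ih =>
    simp only [mderivList, MvPolynomial.coeff_pderiv]
    rw [ih, zero_mul]
    simp only [map_add, Finsupp.degree_single, List.length_cons] at hd ⊢
    omega

lemma mderivList_const {n : ℕ} (l : List (Fin n)) (P : MvPolynomial (Fin n) ℝ)
    (hP : P.totalDegree ≤ l.length) (x y : Fin n → ℝ) :
    MvPolynomial.eval x (mderivList l P) = MvPolynomial.eval y (mderivList l P) := by
  have : mderivList l P = MvPolynomial.C ((mderivList l P).coeff 0) := by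
    ext d
    rw [MvPolynomial.coeff_C]
    split_ifs with h
    · rw [← h]
    · apply mderivList_coeff_eq_zero l P _ hP
      have : d.degree ≠ 0 := fun h0 => h ((Finsupp.degree_eq_zero_iff d).1 h0).symm
      omega
  rw [this]; simp

lemma contDiff_eval {n : ℕ} (P : MvPolynomial (Fin n) ℝ) (k : WithTop ℕ∞) :
    ContDiff ℝ k (fun z : Fin n → ℝ => MvPolynomial.eval z P) := by
  induction P using MvPolynomial.induction_on with
  | C a => simp only [MvPolynomial.eval_C]; fun_prop
  | add p q hp hq => simp only [map_add]; fun_prop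
  | mul_X p i hp => simp only [map_mul, MvPolynomial.eval_X]; fun_prop

lemma pdIdx_eval {n : ℕ} (i : Fin n) (P : MvPolynomial (Fin n) ℝ) :
    pdIdx n i (fun z => MvPolynomial.eval z P) =
      fun z => MvPolynomial.eval z (MvPolynomial.pderiv i P) := by
  have hd : ∀ P : MvPolynomial (Fin n) ℝ, ∀ x,
      DifferentiableAt ℝ (fun z : Fin n → ℝ => MvPolynomial.eval z P) x :=
    fun P x => ((contDiff_eval P 1).differentiable (by norm_num)) x
  induction P using MvPolynomial.induction_on with
  | C a => ext x; simp [pdIdx]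
  | add p q hp hq =>
    ext x
    have hp' := congrFun hp x
    have hq' := congrFun hq x
    simp only [pdIdx] at *
    simp only [map_add]
    rw [fderiv_fun_add (hd p x) (hd q x)]
    simp [hp', hq']
  | mul_X p j hp =>
    ext x
    have hp' := congrFun hp x
    simp only [pdIdx] at *
    simp only [map_mul, MvPolynomial.eval_X]
    rw [fderiv_fun_mul (hd p x) (by fun_prop)]
    simp only [add_apply, smul_apply, hp']
    rw [show fderiv ℝ (fun z : Fin n → ℝ => z j) x = ContinuousLinearMap.proj j from
      (ContinuousLinearMap.proj (R := ℝ) (φ := fun _ : Fin n => ℝ) j).fderiv]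
    simp [MvPolynomial.pderiv_mul, MvPolynomial.pderiv_X, Pi.single_apply]
    by_cases h : i = j
    · subst h; simp
    · have h' : j ≠ i := fun hh => h hh.symm
      simp [h']

lemma pdList_eval {n : ℕ} (l : List (Fin n)) (P : MvPolynomial (Fin n) ℝ) :
    pdList n l (fun z => MvPolynomial.eval z P) =
      fun z => MvPolynomial.eval z (mderivList l P) := by
  induction l with
  | nil => rfl
  | cons a l ih => simp only [pdList, mderivList, ih, pdIdx_eval]

lemma iteratedFDeriv_eq_pdList {n : ℕ} {j : ℕ} (r : Fin j → Fin n) (f : (Fin n → ℝ) → ℝ) (N : ℕ)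
    (hf : ContDiff ℝ N f) (hl : j ≤ N) :
    pdList n (List.ofFn r) f = fun x => iteratedFDeriv ℝ j f x
      (fun k => (Pi.single (r k) 1 : Fin n → ℝ)) := by
  induction j with
  | zero => ext x; simp [pdList]
  | succ j ih =>
    ext x
    have ih := ih (fun k => r k.succ) (by omega)
    simp only [List.ofFn_succ, pdList, pdIdx, ih]
    have hd : DifferentiableAt ℝ (iteratedFDeriv ℝ j f) x :=
      (hf.differentiable_iteratedFDeriv (by exact_mod_cast hl)) x
    have h2 : HasFDerivAt (fun x => iteratedFDeriv ℝ j f x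
        (fun k => (Pi.single (r k.succ) 1 : Fin n → ℝ)))
        ((ContinuousMultilinearMap.apply ℝ (fun _ : Fin j => (Fin n → ℝ)) ℝ
          (fun k => (Pi.single (r k.succ) 1 : Fin n → ℝ))).comp
            (fderiv ℝ (iteratedFDeriv ℝ j f) x)) x :=
      ((ContinuousMultilinearMap.apply ℝ (fun _ : Fin j => (Fin n → ℝ)) ℝ
          (fun k => (Pi.single (r k.succ) 1 : Fin n → ℝ))).hasFDerivAt).comp x hd.hasFDerivAt
    rw [h2.fderiv]
    rw [iteratedFDeriv_succ_apply_left]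
    rfl

lemma pdList_congr {n : ℕ} (l : List (Fin n)) (f g : (Fin n → ℝ) → ℝ) (N : ℕ)
    (hf : ContDiff ℝ N f) (hg : ContDiff ℝ N g) (hl : l.length ≤ N) (x : Fin n → ℝ)
    (h : iteratedFDeriv ℝ l.length f x = iteratedFDeriv ℝ l.length g x) :
    pdList n l f x = pdList n l g x := by
  have h1 := congrFun (iteratedFDeriv_eq_pdList l.get f N hf hl) x
  have h2 := congrFun (iteratedFDeriv_eq_pdList l.get g N hg hl) x
  rw [List.ofFn_get] at h1 h2
  rw [h1, h2, h]

lemma coeff_mderivList {n : ℕ} (l : List (Fin n)) (P : MvPolynomial (Fin n) ℝ) (d e : Fin n →₀ ℕ)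
    (he : ∀ i, e i = d i + l.count i) :
    (mderivList l P).coeff d * ∏ i, ((d i).factorial : ℝ) =
      P.coeff e * ∏ i, ((e i).factorial : ℝ) := by
  induction l generalizing d with
  | nil =>
    have : e = d := by ext i; simp [he]
    rw [this]; rfl
  | cons a l ih =>
    have := ih (d + Finsupp.single a 1) (by
      intro i; rw [he i, List.count_cons]; simp [Finsupp.single_apply]; split_ifs <;> omega)
    rw [← this]
    simp only [mderivList, MvPolynomial.coeff_pderiv, mul_assoc]
    congr 1
    rw [← Finset.mul_prod_erase _ _ (Finset.mem_univ a),
      ← Finset.mul_prod_erase (a := a) _ (fun i => (((d + Finsupp.single a 1 : Fin n →₀ ℕ) i).factorial : ℝ))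
        (Finset.mem_univ a), ← mul_assoc]
    congr 1
    · simp [Nat.factorial_succ]
    · apply Finset.prod_congr rfl
      intro i hi
      have : a ≠ i := fun h => by simp [h] at hi
      simp [Finsupp.single_apply, this]

/-- translation -/
def ptrans {n : ℕ} (x : Fin n → ℝ) : MvPolynomial (Fin n) ℝ →ₐ[ℝ] MvPolynomial (Fin n) ℝ :=
  MvPolynomial.aeval (fun i => MvPolynomial.X i + MvPolynomial.C (x i))

lemma trans_pderiv {n : ℕ} (x : Fin n → ℝ) (i : Fin n) (P : MvPolynomial (Fin n) ℝ) :
    ptrans x (MvPolynomial.pderiv i P) = MvPolynomial.pderiv i (ptrans x P) := by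
  unfold ptrans
  induction P using MvPolynomial.induction_on with
  | C a => simp
  | add p q hp hq => simp only [map_add, hp, hq]
  | mul_X p j hp =>
    simp only [MvPolynomial.pderiv_mul, map_add, map_mul, hp, MvPolynomial.aeval_X,
      MvPolynomial.pderiv_X, MvPolynomial.pderiv_C, add_zero, Pi.single_apply]
    by_cases h : j = i <;> simp [h]

lemma trans_mderivList {n : ℕ} (x : Fin n → ℝ) (l : List (Fin n)) (P : MvPolynomial (Fin n) ℝ) :
    ptrans x (mderivList l P) = mderivList l (ptrans x P) := by
  induction l with
  | nil => rfl
  | cons a l ih => simp only [mderivList, trans_pderiv, ih]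

lemma coeff_zero_trans {n : ℕ} (x : Fin n → ℝ) (P : MvPolynomial (Fin n) ℝ) :
    (ptrans x P).coeff 0 = MvPolynomial.eval x P := by
  change MvPolynomial.constantCoeff (ptrans x P) = _
  unfold ptrans
  induction P using MvPolynomial.induction_on with
  | C a => simp
  | add p q hp hq => simp only [map_add, hp, hq]
  | mul_X p j hp => simp only [map_mul, hp, MvPolynomial.aeval_X]; simp

lemma eval_mderiv {n : ℕ} (x : Fin n → ℝ) (P : MvPolynomial (Fin n) ℝ) (β : Fin n → ℕ) :
    MvPolynomial.eval x (mderiv β P) =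
      (ptrans x P).coeff (Finsupp.equivFunOnFinite.symm β) * ∏ i, ((β i).factorial : ℝ) := by
  have h := coeff_mderivList (canon β) (ptrans x P) 0 (Finsupp.equivFunOnFinite.symm β)
    (by intro i; simp [count_canon])
  rw [← trans_mderivList, coeff_zero_trans] at h
  have h' : MvPolynomial.eval x (mderivList (canon β) P) =
      (ptrans x P).coeff (Finsupp.equivFunOnFinite.symm β) * ∏ i, ((β i).factorial : ℝ) := by
    simpa using h
  exact h'

lemma totalDegree_ptrans {n : ℕ} (x : Fin n → ℝ) (P : MvPolynomial (Fin n) ℝ) (d : Fin n →₀ ℕ)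
    (hd : P.totalDegree < d.degree) : (ptrans x P).coeff d = 0 := by
  have h := coeff_mderivList (canon d) (ptrans x P) 0 d (by intro i; simp [count_canon])
  rw [← trans_mderivList, coeff_zero_trans] at h
  have h0 : mderivList (canon d) P = 0 := by
    ext e
    rw [mderivList_coeff_eq_zero _ P _ le_rfl, MvPolynomial.coeff_zero]
    rw [length_canon, ← Finsupp.degree_eq_sum]
    omega
  rw [h0] at h
  have h1 : ∏ i, ((d i).factorial : ℝ) ≠ 0 :=
    Finset.prod_ne_zero_iff.2 fun i _ => by exact_mod_cast (d i).factorial_ne_zero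
  simp only [map_zero, zero_mul] at h
  exact (mul_eq_zero.1 h.symm).resolve_right h1

lemma taylor_poly {n m : ℕ} (hm : 1 ≤ m) (x : Fin n → ℝ) (P : MvPolynomial (Fin n) ℝ)
    (hP : P.totalDegree ≤ m - 1) :
    ∑ α ∈ multiIndices n m,
    MvPolynomial.C (MvPolynomial.eval x (mderiv α P) / ∏ i, (Nat.factorial (α i) : ℝ)) *
      ∏ i, (MvPolynomial.X i - MvPolynomial.C (x i)) ^ α i = P := by
  have h1 : ∀ P : MvPolynomial (Fin n) ℝ,
      MvPolynomial.aeval (fun i => MvPolynomial.X i - MvPolynomial.C (x i)) (ptrans x P) = P := by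
    intro P
    unfold ptrans
    induction P using MvPolynomial.induction_on with
    | C a => simp [MvPolynomial.algebraMap_eq]
    | add p q hp hq => rw [map_add, map_add, hp, hq]
    | mul_X p j hp => 
      rw [map_mul, map_mul, hp]
      simp [MvPolynomial.algebraMap_eq]
  conv_rhs => rw [← h1 P, MvPolynomial.aeval_def, MvPolynomial.eval₂_eq']
  have h2 : (ptrans x P).support ⊆
      (multiIndices n m).map Finsupp.equivFunOnFinite.symm.toEmbedding := by
    intro d hd
    rw [Finset.mem_map]
    refine ⟨d, ?_, by ext i; simp⟩
    rw [mem_multiIndices hm, ← Finsupp.degree_eq_sum]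
    by_contra hc
    exact (MvPolynomial.mem_support_iff.1 hd) (totalDegree_ptrans x P d (by omega))
  rw [Finset.sum_subset h2, Finset.sum_map]
  · apply Finset.sum_congr rfl
    intro α _
    rw [eval_mderiv, mul_div_assoc, div_self, mul_one]
    · rfl
    · exact Finset.prod_ne_zero_iff.2 fun i _ => by exact_mod_cast (α i).factorial_ne_zero
  · intro d _ hd
    rw [MvPolynomial.notMem_support_iff.1 hd]
    simp

lemma glue_taylor {E : Type*} [NormedAddCommGroup E] [NormedSpace ℝ E] {N : ℕ} {f g : E → ℝ}
    {p q : E → FormalMultilinearSeries ℝ E ℝ} {s t : Set E} (hs : IsClosed s) (ht : IsClosed t)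
    (hf : HasFTaylorSeriesUpToOn N f p s) (hg : HasFTaylorSeriesUpToOn N g q t)
    (hpq : ∀ x ∈ s, x ∈ t → ∀ j ≤ N, p x j = q x j) :
    ∃ (h : E → ℝ) (r : E → FormalMultilinearSeries ℝ E ℝ), HasFTaylorSeriesUpToOn N h r (s ∪ t) ∧ Set.EqOn h f s := by
  classical
  refine ⟨fun x => if x ∈ s then f x else g x, fun x => if x ∈ s then p x else q x, ?_,
    fun x hx => by simp [hx]⟩
  have hrs : ∀ x ∈ s, ∀ j, (if x ∈ s then p x else q x) j = p x j := fun x hx j => by simp [hx]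
  have hrt : ∀ x ∈ t, ∀ j ≤ N, (if x ∈ s then p x else q x) j = q x j := by
    intro x hx j hj
    split_ifs with h
    · exact hpq x h hx j hj
    · rfl
  constructor
  · intro x hx
    by_cases h : x ∈ s
    · simp only [h, if_true]; exact hf.zero_eq x h
    · simp only [h, if_false]; exact hg.zero_eq x (hx.resolve_left h)
  · intro j hj x hx
    have hj' : j < N := by exact_mod_cast hj
    apply HasFDerivWithinAt.union
    · by_cases h : x ∈ s
      · have := (hf.fderivWithin j hj x h).congr (fun y hy => hrs y hy j) (hrs x h j)
        rw [hrs x h]; exact this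
      · apply HasFDerivWithinAt.of_notMem_closure
        rwa [hs.closure_eq]
    · by_cases h : x ∈ t
      · have := (hg.fderivWithin j hj x h).congr (fun y hy => hrt y hy j hj'.le) (hrt x h j hj'.le)
        rw [hrt x h _ hj']; exact this
      · apply HasFDerivWithinAt.of_notMem_closure
        rwa [ht.closure_eq]
  · intro j hj
    have hj' : j ≤ N := by exact_mod_cast hj
    apply ContinuousOn.union_of_isClosed _ _ hs ht
    · exact (hf.cont j hj).congr fun y hy => hrs y hy j
    · exact (hg.cont j hj).congr fun y hy => hrt y hy j hj'

lemma exists_coeffs (N : ℕ) : ∃ c τ : Fin (N + 1) → ℝ, (∀ k, -1 ≤ τ k ∧ τ k ≤ 0) ∧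
    ∀ r ≤ N, ∑ k, c k * (τ k - 1) ^ r = if r = 0 then 1 else 0 := by
  let τ : Fin (N + 1) → ℝ := fun k => -((k : ℕ) : ℝ) / (N + 1)
  have hN : (0 : ℝ) < N + 1 := by positivity
  have hinj : Set.InjOn τ (Finset.univ : Finset (Fin (N + 1))) := by
    intro a _ b _ h
    simp only [τ] at h
    rw [div_left_inj' hN.ne', neg_inj, Nat.cast_inj] at h
    exact Fin.ext h
  refine ⟨fun k => (Lagrange.basis Finset.univ τ k).eval 1, τ, ?_, ?_⟩
  · intro k
    have h1 : ((k : ℕ) : ℝ) ≤ N := by exact_mod_cast Nat.lt_succ_iff.1 k.2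
    have h0 : (0 : ℝ) ≤ ((k : ℕ) : ℝ) := by positivity
    simp only [τ]
    rw [le_div_iff₀ hN, div_le_iff₀ hN]
    constructor <;> linarith
  · intro r hr
    have hdeg : ((Polynomial.X - Polynomial.C (1 : ℝ)) ^ r).degree
        < ((Finset.univ : Finset (Fin (N + 1))).card : WithBot ℕ) := by
      rw [Polynomial.degree_pow, Polynomial.degree_X_sub_C, Finset.card_univ, Fintype.card_fin]
      rw [nsmul_one]
      exact_mod_cast Nat.lt_succ_of_le hr
    have := congrArg (Polynomial.eval 1) (Lagrange.eq_interpolate hinj hdeg)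
    rw [Lagrange.interpolate_apply, Polynomial.eval_finsetSum] at this
    simp only [Polynomial.eval_mul, Polynomial.eval_C, Polynomial.eval_pow, Polynomial.eval_sub,
      Polynomial.eval_X, sub_self] at this
    rw [← zero_pow_eq, this]
    apply Finset.sum_congr rfl
    intro k _
    ring

lemma multilinear_reflect {E : Type*} [NormedAddCommGroup E] [NormedSpace ℝ E] (j : ℕ)
    (M : ContinuousMultilinearMap ℝ (fun _ : Fin j => E) ℝ) {N : ℕ} (hj : j ≤ N)
    (c τ : Fin (N + 1) → ℝ)
    (hc : ∀ r ≤ N, ∑ k, c k * (τ k - 1) ^ r = if r = 0 then 1 else 0) (v u : Fin j → E) :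
    ∑ k, c k * M (fun i => v i + (τ k - 1) • u i) = M v := by
  have h1 : ∀ k, M (fun i => v i + (τ k - 1) • u i) =
      ∑ S : Finset (Fin j), (τ k - 1) ^ S.card * M (S.piecewise u v) := by
    intro k
    have h := M.toMultilinearMap.map_add_univ (fun i => (τ k - 1) • u i) v
    have h2 : M (fun i => v i + (τ k - 1) • u i) =
      M.toMultilinearMap ((fun i => (τ k - 1) • u i) + v) := by
      change M _ = M _; congr 1; ext1 i; simp [add_comm]
    rw [h2, h]
    apply Finset.sum_congr rfl
    intro S _
    have h3 := M.toMultilinearMap.map_piecewise_smul (fun _ => τ k - 1) (S.piecewise u v) S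
    simp only [Finset.prod_const, smul_eq_mul] at h3
    rw [show M (S.piecewise u v) = M.toMultilinearMap (S.piecewise u v) from rfl, ← h3]
    congr 1
    ext i
    by_cases hi : i ∈ S <;> simp [hi]
  simp only [h1, Finset.mul_sum]
  rw [Finset.sum_comm]
  simp only [← mul_assoc, ← Finset.sum_mul]
  rw [Finset.sum_eq_single ∅]
  · rw [hc _ (by simp)]; simp
  · intro S _ hS
    have : S.card ≤ j := by simpa using S.card_le_univ
    rw [hc _ (this.trans hj)]; simp [hS]
  · simp

lemma taylor_sum {E : Type*} [NormedAddCommGroup E] [NormedSpace ℝ E] {N : ℕ} {ι : Type*}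
    (K : Finset ι) (c : ι → ℝ) (f : ι → E → ℝ)
    (p : ι → E → FormalMultilinearSeries ℝ E ℝ) {t : Set E}
    (hf : ∀ k ∈ K, HasFTaylorSeriesUpToOn N (f k) (p k) t) :
    HasFTaylorSeriesUpToOn N (fun x => ∑ k ∈ K, c k * f k x)
      (fun x j => ∑ k ∈ K, c k • p k x j) t := by
  constructor
  · intro x hx
    simp only [ContinuousMultilinearMap.curry0_apply, sum_apply,
      smul_apply, smul_eq_mul]
    apply Finset.sum_congr rfl
    intro k hk
    rw [← (hf k hk).zero_eq x hx]; rfl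
  · intro j hj x hx
    have := HasFDerivWithinAt.fun_sum (u := K) (fun k hk => ((hf k hk).fderivWithin j hj x hx).const_smul (c k))
    convert! this using 1
    ext y v
    simp
  · intro j hj
    exact continuousOn_finsetSum K fun k hk => ((hf k hk).cont j hj).const_smul (c k)

lemma reflect_step {n N : ℕ} (i : Fin n) (b : ℝ) {f : (Fin n → ℝ) → ℝ}
    {p : (Fin n → ℝ) → FormalMultilinearSeries ℝ (Fin n → ℝ) ℝ} {s t : Set (Fin n → ℝ)}
    (hs : IsClosed s) (ht : IsClosed t) (hf : HasFTaylorSeriesUpToOn N f p s)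
    (hst : ∀ x ∈ s, x ∈ t → x i = b)
    (hmap : ∀ x ∈ t, ∀ τ : ℝ, -1 ≤ τ → τ ≤ 0 → x + ((τ - 1) * (x i - b)) • Pi.single i 1 ∈ s) :
    ∃ (h : (Fin n → ℝ) → ℝ) (r : (Fin n → ℝ) → FormalMultilinearSeries ℝ (Fin n → ℝ) ℝ), HasFTaylorSeriesUpToOn N h r (s ∪ t) ∧ Set.EqOn h f s := by
  obtain ⟨c, τ, hτ, hc⟩ := exists_coeffs N
  let L : Fin (N + 1) → ((Fin n → ℝ) →L[ℝ] (Fin n → ℝ)) := fun k =>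
    ContinuousLinearMap.id ℝ _ + (τ k - 1) •
      (ContinuousLinearMap.proj (R := ℝ) (φ := fun _ : Fin n => ℝ) i).smulRight (Pi.single i 1)
  let φ : Fin (N + 1) → ((Fin n → ℝ) →ᴬ[ℝ] (Fin n → ℝ)) := fun k =>
    (L k).toContinuousAffineMap +
      ContinuousAffineMap.const ℝ (Fin n → ℝ) ((-(τ k - 1) * b) • (Pi.single i 1 : Fin n → ℝ))
  have hφ : ∀ k x, φ k x = x + ((τ k - 1) * (x i - b)) • Pi.single i 1 := by
    intro k x
    simp only [φ, L]
    simp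
    module
  have hlin : ∀ k, (φ k).contLinear = L k := by
    intro k
    ext v
    simp [φ]
  have hk : ∀ k ∈ (Finset.univ : Finset (Fin (N + 1))), HasFTaylorSeriesUpToOn N (f ∘ φ k)
      (fun x j => (p (φ k x) j).compContinuousLinearMap fun _ => (φ k).contLinear) t := by
    intro k _
    refine (hf.comp_continuousAffineMap (φ k)).mono ?_
    intro x hx
    simp only [Set.mem_preimage, hφ]
    exact hmap x hx _ (hτ k).1 (hτ k).2
  refine glue_taylor hs ht hf (taylor_sum Finset.univ c _ _ hk) ?_
  intro x hxs hxt j hj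
  ext v
  have hx : ∀ k, φ k x = x := by intro k; rw [hφ, hst x hxs hxt]; simp
  rw [sum_apply]
  simp only [hx, hlin, smul_apply, smul_eq_mul,
    ContinuousMultilinearMap.compContinuousLinearMap_apply]
  rw [← multilinear_reflect j (p x j) hj c τ hc v (fun l => v l i • Pi.single i 1)]
  simp [L]

/-- intermediate boxes -/
def ibox {n : ℕ} (ctr : Fin n → ℝ) (δ : ℝ) (T : Finset (Fin n)) : Set (Fin n → ℝ) :=
  {x | ∀ i, |x i - ctr i| ≤ if i ∈ T then 3 * δ / 2 else δ / 2}

lemma isClosed_ibox {n : ℕ} (ctr : Fin n → ℝ) (δ : ℝ) (T : Finset (Fin n)) :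
    IsClosed (ibox ctr δ T) := by
  unfold ibox
  rw [Set.ofPred_forall]
  exact isClosed_iInter fun i => isClosed_le (by fun_prop) (by fun_prop)

lemma extend_box {n N : ℕ} (ctr : Fin n → ℝ) (δ : ℝ) (hδ : 0 < δ) {f : (Fin n → ℝ) → ℝ}
    {p : (Fin n → ℝ) → FormalMultilinearSeries ℝ (Fin n → ℝ) ℝ}
    (hf : HasFTaylorSeriesUpToOn N f p (ibox ctr δ ∅)) (T : Finset (Fin n)) :
    ∃ (h : (Fin n → ℝ) → ℝ) (r : (Fin n → ℝ) → FormalMultilinearSeries ℝ (Fin n → ℝ) ℝ), HasFTaylorSeriesUpToOn N h r (ibox ctr δ T) ∧ Set.EqOn h f (ibox ctr δ ∅) := by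
  induction T using Finset.induction_on with
  | empty => exact ⟨f, p, hf, fun _ _ => rfl⟩
  | insert i T hi ih =>
    obtain ⟨h, r, hr, he⟩ := ih
    let t1 : Set (Fin n → ℝ) := ibox ctr δ (insert i T) ∩ {x | x i ≤ ctr i - δ / 2}
    let t2 : Set (Fin n → ℝ) := ibox ctr δ (insert i T) ∩ {x | ctr i + δ / 2 ≤ x i}
    have c1 : IsClosed t1 := (isClosed_ibox _ _ _).inter (isClosed_le (by fun_prop) (by fun_prop))
    have c2 : IsClosed t2 := (isClosed_ibox _ _ _).inter (isClosed_le (by fun_prop) (by fun_prop))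
    have hmem : ∀ x ∈ ibox ctr δ (insert i T), ∀ y : ℝ, |x i + y - ctr i| ≤ δ / 2 →
        x + y • Pi.single i 1 ∈ ibox ctr δ T := by
      intro x hx y hy j
      by_cases hj : j = i
      · subst hj; simpa [hi] using hy
      · have := hx j
        simpa [hj] using this
    have hT : ∀ x ∈ ibox ctr δ T, |x i - ctr i| ≤ δ / 2 := by
      intro x hx; simpa [hi] using hx i
    have hI : ∀ x ∈ ibox ctr δ (insert i T), |x i - ctr i| ≤ 3 * δ / 2 := by
      intro x hx; simpa using hx i
    obtain ⟨h1, r1, hr1, he1⟩ := reflect_step i (ctr i - δ / 2) (isClosed_ibox ctr δ T) c1 hr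
      (by
        intro x hx hx1
        have := abs_le.1 (hT x hx)
        have h2 : x i ≤ ctr i - δ / 2 := hx1.2
        linarith)
      (by
        intro x hx τ h1 h2
        apply hmem x hx.1
        have h3 : x i ≤ ctr i - δ / 2 := hx.2
        have h4 := abs_le.1 (hI x hx.1)
        rw [abs_le]
        constructor <;> nlinarith)
    obtain ⟨h2, r2, hr2, he2⟩ := reflect_step i (ctr i + δ / 2)
      ((isClosed_ibox ctr δ T).union c1) c2 hr1
      (by
        intro x hx hx1
        have h2 : ctr i + δ / 2 ≤ x i := hx1.2
        rcases hx with hx | hx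
        · have := abs_le.1 (hT x hx)
          linarith
        · have : x i ≤ ctr i - δ / 2 := hx.2
          linarith)
      (by
        intro x hx τ h1 h2
        left
        apply hmem x hx.1
        have h3 : ctr i + δ / 2 ≤ x i := hx.2
        have h4 := abs_le.1 (hI x hx.1)
        rw [abs_le]
        constructor <;> nlinarith)
    have hsub : ibox ctr δ ∅ ⊆ ibox ctr δ T := by
      intro x hx j
      have := hx j
      simp only [Finset.notMem_empty, if_false] at this
      split_ifs <;> linarith
    refine ⟨h2, r2, hr2.mono ?_, ?_⟩
    · intro x hx
      by_cases hx1 : x i ≤ ctr i - δ / 2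
      · exact Or.inl (Or.inr ⟨hx, hx1⟩)
      by_cases hx2 : ctr i + δ / 2 ≤ x i
      · exact Or.inr ⟨hx, hx2⟩
      left; left
      have := hmem x hx 0 (by rw [abs_le]; constructor <;> linarith)
      simpa using this
    · intro x hx
      rw [he2 (Or.inl (hsub hx)), he1 (hsub hx), he hx]

lemma cutoff {n N : ℕ} (ctr : Fin n → ℝ) (δ : ℝ) (hδ : 0 < δ) {f : (Fin n → ℝ) → ℝ}
    (hf : ContDiffOn ℝ N f (ibox ctr δ Finset.univ)) :
    ∃ G, ContDiff ℝ N G ∧ Set.EqOn G f (cube n ctr δ) := by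
  have hsub : Metric.closedBall ctr δ ⊆ ibox ctr δ Finset.univ := by
    intro x hx i
    rw [Metric.mem_closedBall, dist_pi_le_iff hδ.le] at hx
    have := hx i
    rw [Real.dist_eq] at this
    simp; linarith
  have h0 : cube n ctr δ = Metric.closedBall ctr (δ / 2) := by
    ext x
    rw [Metric.mem_closedBall, dist_pi_le_iff (by positivity)]
    rfl
  obtain ⟨χ, hχ1, hχ2⟩ : ∃ χ : (Fin n → ℝ) → ℝ, ContDiff ℝ N χ ∧
      tsupport χ ⊆ Metric.ball ctr δ ∧ ∀ x ∈ Metric.closedBall ctr (δ / 2), χ x = 1 := by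
    have hc1 : IsClosed (Metric.ball ctr δ)ᶜ := Metric.isOpen_ball.isClosed_compl
    have hd : Disjoint (Metric.ball ctr δ)ᶜ (Metric.closedBall ctr (δ / 2)) := by
      rw [Set.disjoint_compl_left_iff_subset]
      exact Metric.closedBall_subset_ball (by linarith)
    obtain ⟨χ, h1, h2, -⟩ := exists_contMDiffMap_zero_one_nhds_of_isClosed
      (n := (N : ℕ∞)) (modelWithCornersSelf ℝ (Fin n → ℝ)) hc1 Metric.isClosed_closedBall hd
    refine ⟨χ, χ.contMDiff.contDiff, ?_, ?_⟩
    · intro x hx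
      by_contra hxb
      have h3 := Filter.Eventually.filter_mono (nhds_le_nhdsSet (s := (Metric.ball ctr δ)ᶜ) hxb) h1
      exact (notMem_tsupport_iff_eventuallyEq.2 h3) hx
    · intro x hx
      exact (Filter.Eventually.filter_mono (nhds_le_nhdsSet hx) h2).self_of_nhds
  refine ⟨fun x => χ x * f x, ?_, ?_⟩
  · rw [contDiff_iff_contDiffAt]
    intro x
    by_cases hx : x ∈ tsupport χ
    · apply hχ1.contDiffAt.mul
      apply hf.contDiffAt
      exact Filter.mem_of_superset (Metric.isOpen_ball.mem_nhds (hχ2.1 hx))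
        (Metric.ball_subset_closedBall.trans hsub)
    · have : (fun x => χ x * f x) =ᶠ[nhds x] fun _ => 0 := by
        filter_upwards [(isClosed_tsupport χ).isOpen_compl.mem_nhds hx] with y hy
        rw [image_eq_zero_of_notMem_tsupport hy, zero_mul]
      exact contDiffAt_const.congr_of_eventuallyEq this
  · intro x hx
    simp only
    rw [hχ2.2 x (h0 ▸ hx), one_mul]

lemma norm_iter_le {n : ℕ} (P : MvPolynomial (Fin n) ℝ) (j : ℕ) (x : Fin n → ℝ) (B : ℝ)
    (hB : 0 ≤ B)
    (h : ∀ l : List (Fin n), l.length = j → |MvPolynomial.eval x (mderivList l P)| ≤ B) :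
    ‖iteratedFDeriv ℝ j (fun z : Fin n → ℝ => MvPolynomial.eval z P) x‖ ≤ (n : ℝ) ^ j * B := by
  set M := iteratedFDeriv ℝ j (fun z : Fin n → ℝ => MvPolynomial.eval z P) x with hM
  apply ContinuousMultilinearMap.opNorm_le_bound (by positivity)
  intro v
  have h1 : M v = ∑ r : Fin j → Fin n, (∏ k, v k (r k)) *
      M (fun k => (Pi.single (r k) 1 : Fin n → ℝ)) := by
    have hv : v = fun k => ∑ i, v k i • (Pi.single i 1 : Fin n → ℝ) := by
      ext1 k
      ext i
      simp [Finset.sum_apply, Pi.single_apply]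
    conv_lhs => rw [hv]
    rw [ContinuousMultilinearMap.map_sum]
    apply Finset.sum_congr rfl
    intro r _
    rw [ContinuousMultilinearMap.map_smul_univ, smul_eq_mul]
  rw [h1]
  refine (norm_sum_le _ _).trans ?_
  have h2 : ∀ r ∈ (Finset.univ : Finset (Fin j → Fin n)), ‖(∏ k, v k (r k)) *
      M (fun k => (Pi.single (r k) 1 : Fin n → ℝ))‖ ≤ B * ∏ k, ‖v k‖ := by
    intro r _
    rw [norm_mul, mul_comm, norm_prod]
    apply mul_le_mul
    · have h3 := congrFun (iteratedFDeriv_eq_pdList r _ j (contDiff_eval P _) le_rfl) x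
      rw [pdList_eval] at h3
      rw [hM, ← h3, Real.norm_eq_abs]
      exact h _ (by simp)
    · exact Finset.prod_le_prod (fun _ _ => norm_nonneg _) fun k _ => norm_le_pi_norm (v k) (r k)
    · exact Finset.prod_nonneg fun _ _ => norm_nonneg _
    · exact hB
  refine (Finset.sum_le_sum h2).trans ?_
  simp [mul_assoc]

lemma pNorm_bound {n m : ℕ} (hm : 1 ≤ m) {p : ℝ} (hp : 0 < p) (P : MvPolynomial (Fin n) ℝ)
    (x : Fin n → ℝ) (δ A : ℝ) (hδ : 0 < δ) (h : pNorm n m p P x δ ≤ A) (l : List (Fin n))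
    (hl : l.length ≤ m - 1) :
    |MvPolynomial.eval x (mderivList l P)| ≤ A * δ ^ ((m : ℝ) - l.length - n / p) := by
  rw [mderivList_eq_mderiv]
  set β : Fin n → ℕ := fun i => l.count i with hβ
  have hs : ∑ i, β i = l.length := (length_eq_sum_count l).symm
  have hmem : β ∈ multiIndices n m := by rw [mem_multiIndices hm, hs]; exact hl
  have hnn : ∀ γ ∈ multiIndices n m, 0 ≤ |MvPolynomial.eval x (mderiv γ P)| ^ p *
        δ ^ ((n : ℝ) + ((∑ i, γ i : ℕ) : ℝ) * p - (m : ℝ) * p) := fun γ _ => by positivity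
  have h1 := Finset.single_le_sum hnn hmem
  have h2 := (Real.rpow_le_rpow (hnn β hmem) h1 (by positivity : 0 ≤ 1 / p)).trans h
  rw [Real.mul_rpow (by positivity) (by positivity), ← Real.rpow_mul (abs_nonneg _),
    ← Real.rpow_mul hδ.le, mul_one_div_cancel hp.ne', Real.rpow_one, hs] at h2
  have h3 : δ ^ (((n : ℝ) + (l.length : ℝ) * p - m * p) * (1 / p)) *
      δ ^ ((m : ℝ) - l.length - n / p) = 1 := by
    rw [← Real.rpow_add hδ]
    convert Real.rpow_zero δ using 2
    field_simp
    ring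
  calc _ = |MvPolynomial.eval x (mderiv β P)| * (δ ^ (((n : ℝ) + (l.length : ℝ) * p - m * p) * (1 / p)) *
      δ ^ ((m : ℝ) - l.length - n / p)) := by rw [h3, mul_one]
    _ ≤ _ := by
      rw [← mul_assoc]
      exact mul_le_mul_of_nonneg_right h2 (by positivity)

lemma rpow_tendsto {n : ℕ} (s : Set (Fin n → ℝ)) (x : Fin n → ℝ) (K e : ℝ) (he : 0 < e) :
    Filter.Tendsto (fun y : Fin n → ℝ => K * ‖y - x‖ ^ e) (nhdsWithin x s) (nhds 0) := by
  have : Continuous fun y : Fin n → ℝ => K * ‖y - x‖ ^ e :=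
    continuous_const.mul ((continuous_id.sub continuous_const).norm.rpow_const fun _ => Or.inr he.le)
  have h := (this.tendsto x).mono_left (nhdsWithin_le_nhds (s := s))
  simpa [Real.zero_rpow he.ne'] using h

lemma field_taylor {n m : ℕ} (hm : 1 ≤ m) {p : ℝ} (hp0 : 0 < p) (hp : (n : ℝ) < p)
    (s : Set (Fin n → ℝ)) (F : (Fin n → ℝ) → ℝ) (P : (Fin n → ℝ) → MvPolynomial (Fin n) ℝ)
    (A : ℝ) (hA : 0 ≤ A)
    (hF : ∀ x ∈ s, MvPolynomial.eval x (P x) = F x)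
    (hP : ∀ x ∈ s, ∀ y ∈ s, pNorm n m p (P x - P y) x ‖x - y‖ ≤ A) :
    HasFTaylorSeriesUpToOn ((m - 1 : ℕ) : WithTop ℕ∞) F
      (fun x j => iteratedFDeriv ℝ j (fun z : Fin n → ℝ => MvPolynomial.eval z (P x)) x) s := by
  have hnp : (n : ℝ) / p < 1 := (div_lt_one hp0).2 hp
  have hsm : ∀ (Q : MvPolynomial (Fin n) ℝ) (j : ℕ) (x : Fin n → ℝ), DifferentiableAt ℝ
      (iteratedFDeriv ℝ j (fun z : Fin n → ℝ => MvPolynomial.eval z Q)) x := fun Q j x =>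
    ((contDiff_eval Q ((j + 1 : ℕ) : WithTop ℕ∞)).differentiable_iteratedFDeriv
      (by exact_mod_cast Nat.lt_succ_self j)) x
  -- the key difference bound
  have key : ∀ x ∈ s, ∀ y ∈ s, ∀ j ≤ m - 1,
      ‖iteratedFDeriv ℝ j (fun z : Fin n → ℝ => MvPolynomial.eval z (P y)) y -
        iteratedFDeriv ℝ j (fun z : Fin n → ℝ => MvPolynomial.eval z (P x)) y‖ ≤
      ((n : ℝ) ^ j * A) * ‖y - x‖ ^ ((m : ℝ) - j - n / p) := by
    intro x hx y hy j hj
    by_cases hxy : y = x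
    · subst hxy
      rw [sub_self, norm_zero]; positivity
    have h0 : 0 < ‖y - x‖ := norm_pos_iff.2 (sub_ne_zero.2 hxy)
    have h1 : iteratedFDeriv ℝ j (fun z : Fin n → ℝ => MvPolynomial.eval z (P y)) y -
        iteratedFDeriv ℝ j (fun z : Fin n → ℝ => MvPolynomial.eval z (P x)) y =
        iteratedFDeriv ℝ j (fun z : Fin n → ℝ => MvPolynomial.eval z (P y - P x)) y := by
      have : (fun z : Fin n → ℝ => MvPolynomial.eval z (P y - P x)) =
          (fun z : Fin n → ℝ => MvPolynomial.eval z (P y)) -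
          (fun z : Fin n → ℝ => MvPolynomial.eval z (P x)) := by ext z; simp
      rw [this, iteratedFDeriv_sub (contDiff_eval _ _) (contDiff_eval _ _)]
      rfl
    rw [h1, mul_assoc]
    apply norm_iter_le _ _ _ _ (by positivity)
    intro l hl
    have := pNorm_bound hm hp0 _ y _ A h0 (hP y hy x hx) l (by omega)
    rwa [hl] at this
  constructor
  · intro x hx
    simp [hF x hx]
  · intro j hj x hx
    have hj' : j < m - 1 := by exact_mod_cast hj
    have hjm : (j : ℝ) + 2 ≤ m := by
      have : j + 2 ≤ m := by omega
      exact_mod_cast this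
    have hd := (hsm (P x) j x).hasFDerivAt.hasFDerivWithinAt (s := s)
    have hcl : fderiv ℝ (iteratedFDeriv ℝ j (fun z : Fin n → ℝ => MvPolynomial.eval z (P x))) x =
        (iteratedFDeriv ℝ j.succ (fun z : Fin n → ℝ => MvPolynomial.eval z (P x)) x).curryLeft := by
      ext v w
      rw [ContinuousMultilinearMap.curryLeft_apply, iteratedFDeriv_succ_apply_left]
      simp
    rw [hcl] at hd
    have hrem : HasFDerivWithinAt (fun y =>
        iteratedFDeriv ℝ j (fun z : Fin n → ℝ => MvPolynomial.eval z (P y)) y -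
        iteratedFDeriv ℝ j (fun z : Fin n → ℝ => MvPolynomial.eval z (P x)) y)
        (0 : (Fin n → ℝ) →L[ℝ] _) s x := by
      rw [hasFDerivWithinAt_iff_isLittleO]
      simp only [sub_self, sub_zero, zero_apply]
      rw [Asymptotics.isLittleO_iff]
      intro c hc
      have ht := rpow_tendsto s x ((n : ℝ) ^ j * A) ((m : ℝ) - j - n / p - 1) (by linarith)
      filter_upwards [ht.eventually (gt_mem_nhds hc), self_mem_nhdsWithin] with y hy hys
      refine (key x hx y hys j hj'.le).trans ?_
      by_cases hxy : y = x
      · subst hxy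
        rw [sub_self, norm_zero, Real.zero_rpow (by linarith)]; simp
      have h0 : 0 < ‖y - x‖ := norm_pos_iff.2 (sub_ne_zero.2 hxy)
      rw [Real.rpow_sub_one h0.ne', ← mul_div_assoc, div_lt_iff₀ h0] at hy
      exact hy.le
    have := hrem.add hd
    convert! this using 1
    · ext y; simp
    · simp
  · intro j hj x hx
    have hj' : j ≤ m - 1 := by exact_mod_cast hj
    have hjm : (j : ℝ) + 1 ≤ m := by
      have : j + 1 ≤ m := by omega
      exact_mod_cast this
    have hd := (hsm (P x) j x).continuousAt.continuousWithinAt (s := s)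
    have hrem : Filter.Tendsto (fun y =>
        iteratedFDeriv ℝ j (fun z : Fin n → ℝ => MvPolynomial.eval z (P y)) y -
        iteratedFDeriv ℝ j (fun z : Fin n → ℝ => MvPolynomial.eval z (P x)) y)
        (nhdsWithin x s) (nhds 0) := by
      refine squeeze_zero_norm' ?_ (rpow_tendsto s x ((n : ℝ) ^ j * A) ((m : ℝ) - j - n / p)
        (by linarith))
      filter_upwards [self_mem_nhdsWithin] with y hys
      exact key x hx y hys j hj'
    have := hrem.add hd
    simpa [ContinuousWithinAt] using this

/-- **Consequence of the classical Whitney extension theorem (Lemma `whitlm`).**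
Let `Q ⊆ ℝ^n` be a cube, `F : Q → ℝ`, and suppose there are polynomials `P_x` of degree
`≤ m−1` for `x ∈ Q` and a constant `A ≥ 0` with `P_x(x) = F(x)` and
`|P_x − P_y|_{x,|x−y|} ≤ A` for all `x, y ∈ Q`.  Then `F ∈ C^{m−1,1−n/p}(Q)` with
`J_x F = P_x` for all `x ∈ Q` and `‖F‖_{C^{m−1,1−n/p}(Q)} ≤ C A`, `C = C(m,n,p)`
(realized here by a `C^{m−1}` extension `G` of `F` with the prescribed jets and a Hölder
bound on the top derivatives). -/
theorem stmt18 (n m : ℕ) (hn : 1 ≤ n) (hm : 1 ≤ m) (p : ℝ) (hp : (n : ℝ) < p) :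
    ∃ C : ℝ, 0 < C ∧
      ∀ (ctr : Fin n → ℝ) (δ : ℝ), 0 < δ →
      ∀ (F : (Fin n → ℝ) → ℝ) (P : (Fin n → ℝ) → MvPolynomial (Fin n) ℝ) (A : ℝ), 0 ≤ A →
        (∀ x ∈ cube n ctr δ, (P x).totalDegree ≤ m - 1) →
        (∀ x ∈ cube n ctr δ, MvPolynomial.eval x (P x) = F x) →
        (∀ x ∈ cube n ctr δ, ∀ y ∈ cube n ctr δ,
          pNorm n m p (P x - P y) x ‖x - y‖ ≤ A) →
        ∃ G : (Fin n → ℝ) → ℝ, ContDiff ℝ ((m - 1 : ℕ) : ℕ∞) G ∧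
          (∀ x ∈ cube n ctr δ, G x = F x) ∧
          (∀ x ∈ cube n ctr δ, jet n m G x = P x) ∧
          (∀ β : Fin n → ℕ, (∑ i, β i) = m - 1 →
            ∀ x ∈ cube n ctr δ, ∀ y ∈ cube n ctr δ,
              |pdAlpha n β G x - pdAlpha n β G y| ≤ C * A * ‖x - y‖ ^ (1 - (n : ℝ) / p)) := by
  have hp0 : 0 < p := lt_of_le_of_lt (Nat.cast_nonneg n) hp
  refine ⟨1, one_pos, ?_⟩
  intro ctr δ hδ F P A hA hdeg hF hP
  have hcube : cube n ctr δ = ibox ctr δ ∅ := by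
    ext x; simp [cube, ibox]
  have hball : cube n ctr δ = Metric.closedBall ctr (δ / 2) := by
    ext x
    rw [Metric.mem_closedBall, dist_pi_le_iff (by positivity)]
    rfl
  have huniq : UniqueDiffOn ℝ (cube n ctr δ) := by
    rw [hball]
    apply uniqueDiffOn_convex (convex_closedBall _ _)
    exact ⟨ctr, Metric.ball_subset_interior_closedBall (Metric.mem_ball_self (by positivity))⟩
  have hT := field_taylor hm hp0 hp (cube n ctr δ) F P A hA hF hP
  have hT' := hT
  rw [hcube] at hT'
  obtain ⟨f, r, hr, hfF⟩ := extend_box ctr δ hδ hT' Finset.univ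
  have hfc : ContDiffOn ℝ ((m - 1 : ℕ) : WithTop ℕ∞) f (ibox ctr δ Finset.univ) :=
    HasFTaylorSeriesUpToOn.contDiffOn (n := ((m - 1 : ℕ) : ℕ∞)) hr
  obtain ⟨G, hG, hGf⟩ := cutoff ctr δ hδ hfc
  have hGF : ∀ x ∈ cube n ctr δ, G x = F x := fun x hx => by
    rw [hGf hx, hfF (hcube ▸ hx)]
  have hGT := hT.congr hGF
  have hit : ∀ x ∈ cube n ctr δ, ∀ j ≤ m - 1, iteratedFDeriv ℝ j G x =
      iteratedFDeriv ℝ j (fun z : Fin n → ℝ => MvPolynomial.eval z (P x)) x := by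
    intro x hx j hj
    have hj' : (j : WithTop ℕ∞) ≤ ((m - 1 : ℕ) : WithTop ℕ∞) := by exact_mod_cast hj
    rw [← iteratedFDerivWithin_eq_iteratedFDeriv huniq (hG.of_le hj').contDiffAt hx]
    exact (hGT.eq_iteratedFDerivWithin_of_uniqueDiffOn hj' huniq hx).symm
  have hpd : ∀ x ∈ cube n ctr δ, ∀ β : Fin n → ℕ, ∑ i, β i ≤ m - 1 →
      pdAlpha n β G x = MvPolynomial.eval x (mderiv β (P x)) := by
    intro x hx β hβ
    have hl : (canon β).length ≤ m - 1 := by rw [length_canon]; exact hβ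
    have h1 := pdList_congr (canon β) G _ (m - 1) hG (contDiff_eval (P x) _) hl x
      (hit x hx _ hl)
    rw [pdList_eval] at h1
    exact h1
  refine ⟨G, hG, hGF, ?_, ?_⟩
  · intro x hx
    conv_rhs => rw [← taylor_poly hm x (P x) (hdeg x hx)]
    unfold jet
    apply Finset.sum_congr rfl
    intro α hα
    rw [hpd x hx α ((mem_multiIndices hm α).1 hα)]
  · intro β hβ x hx y hy
    rw [hpd x hx β hβ.le, hpd y hy β hβ.le]
    have hl : (canon β).length = m - 1 := by rw [length_canon]; exact hβ
    by_cases hxy : x = y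
    · subst hxy
      rw [sub_self, abs_zero]; positivity
    have h0 : 0 < ‖x - y‖ := norm_pos_iff.2 (sub_ne_zero.2 hxy)
    have h1 := pNorm_bound hm hp0 _ x _ A h0 (hP x hx y hy) (canon β) hl.le
    rw [mderivList_sub, map_sub, mderivList_const (canon β) (P y) (hl ▸ hdeg y hy) x y, hl,
      Nat.cast_sub hm, Nat.cast_one] at h1
    have he : (m : ℝ) - ((m : ℝ) - 1) - n / p = 1 - n / p := by ring
    rw [he] at h1
    rw [one_mul]
    exact h1

end
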